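/- Let (Ω,μ) be a measure space, 1 < q < r, 1 ≤ σ ≤ ∞, ω = min{σ, q}, and (F_j)_{j∈ℤ} a sequence of measurable functions on Ω. Then ‖(∑_j |F_j|^r)^{1/r}‖_{L^{q,σ}(μ)} ≤ C(q,σ,r) (∑_j ‖F_j‖_{L^{q,σ}(μ)}^ω)^{1/ω}. -/

import Mathlib

open MeasureTheory Set ENNReal

/-- The nonincreasing rearrangement of an `ℝ≥0∞`-valued function. -/
noncomputable def rearrangement {α : Type*} [MeasurableSpace α] (μ : Measure α)
    (f : α → ENNReal) (t : ENNReal) : ENNReal :=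
  sInf {l : ENNReal | μ {x | l < f x} ≤ t}

/-- The Lorentz `L^{q,σ}` quasi-norm defined via the nonincreasing rearrangement:
`(∫₀^∞ (t^{1/q} f*(t))^σ dt/t)^{1/σ}`, with the usual `sup` interpretation for `σ = ∞`. -/
noncomputable def lorentzNorm {α : Type*} [MeasurableSpace α] (μ : Measure α)
    (f : α → ENNReal) (q : ℝ) (σ : ENNReal) : ENNReal :=
  if σ = ∞ then ⨆ t : NNReal, (t : ENNReal) ^ (1 / q) * rearrangement μ f t
  else (∫⁻ t in Ioi (0 : ℝ),
      (ENNReal.ofReal t ^ (1 / q) * rearrangement μ f (ENNReal.ofReal t)) ^ σ.toReal *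
        ENNReal.ofReal (1 / t)) ^ (1 / σ.toReal)

lemma lt_rearr_iff {α : Type*} [MeasurableSpace α] (μ : Measure α)
    (f : α → ENNReal) (t l : ENNReal) :
    l < rearrangement μ f t ↔ t < μ {x | l < f x} := by
  constructor
  · intro h
    by_contra! hc
    exact absurd (sInf_le (show l ∈ {l : ENNReal | μ {x | l < f x} ≤ t} from hc)) (not_le.2 h)
  · intro h
    by_contra! hc
    refine absurd h (not_lt.2 ?_)
    rcases eq_or_ne l ∞ with rfl | hl
    · simp
    obtain ⟨u, hu, hul, hlim⟩ := exists_seq_strictAnti_tendsto' (lt_top_iff_ne_top.2 hl)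
    have hset : {x | l < f x} = ⋃ n, {x | u n < f x} := by
      ext x
      simp only [mem_ofPred_eq, mem_iUnion]
      constructor
      · intro hx
        exact (hlim.eventually (gt_mem_nhds hx)).exists
      · rintro ⟨n, hn⟩
        exact (hul n).1.trans hn
    rw [hset, Monotone.measure_iUnion]
    · refine iSup_le fun n => ?_
      have : sInf {l : ENNReal | μ {x | l < f x} ≤ t} < u n := lt_of_le_of_lt hc (hul n).1
      obtain ⟨l', hl', hlt⟩ := sInf_lt_iff.1 this
      exact (measure_mono fun x hx => hlt.trans hx).trans hl'
    · intro m n hmn x hx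
      exact lt_of_le_of_lt (hu.antitone hmn) hx

lemma powint (a : ENNReal) (s : ℝ) (hs : 0 < s) :
    ∫⁻ l in Ioi (0 : ℝ), (if ENNReal.ofReal l < a then ENNReal.ofReal (l ^ (s - 1)) else 0)
      = a ^ s * ENNReal.ofReal (1 / s) := by
  rcases eq_or_ne a ∞ with rfl | ha
  · rw [ENNReal.top_rpow_of_pos hs, ENNReal.top_mul (by simpa using hs)]
    simp only [ENNReal.ofReal_lt_top, if_true]
    by_contra h
    refine not_integrableOn_Ioi_rpow (s - 1) ⟨by fun_prop, ?_⟩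
    rw [hasFiniteIntegral_iff_ofReal]
    · exact lt_top_iff_ne_top.2 h
    · filter_upwards [ae_restrict_mem measurableSet_Ioi] with x hx
      exact Real.rpow_nonneg (le_of_lt hx) _
  · lift a to NNReal using ha
    have h1 : ∀ l ∈ Ioi (0 : ℝ), (if ENNReal.ofReal l < (a : ENNReal) then ENNReal.ofReal (l ^ (s - 1)) else 0)
        = (Iio (a : ℝ)).indicator (fun l => ENNReal.ofReal (l ^ (s - 1))) l := by
      intro l hl
      have : ENNReal.ofReal l < (a : ENNReal) ↔ l < a := by
        rw [← ENNReal.ofReal_coe_nnreal, ENNReal.ofReal_lt_ofReal_iff_of_nonneg (le_of_lt hl)]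
      simp [indicator, this]
    rw [setLIntegral_congr_fun measurableSet_Ioi h1, setLIntegral_indicator measurableSet_Iio,
      inter_comm, Ioi_inter_Iio, setLIntegral_congr Ioo_ae_eq_Ioc,
      ← ofReal_integral_eq_lintegral_ofReal, ← intervalIntegral.integral_of_le a.coe_nonneg, integral_rpow]
    · rw [sub_add_cancel, Real.zero_rpow hs.ne', sub_zero, div_eq_mul_one_div,
        ENNReal.ofReal_mul (by positivity), ← ENNReal.ofReal_rpow_of_nonneg a.coe_nonneg hs.le,
        ENNReal.ofReal_coe_nnreal]
    · left; linarith
    · exact (intervalIntegrable_iff_integrableOn_Ioc_of_le a.2).1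
        (intervalIntegral.intervalIntegrable_rpow' (by linarith))
    · filter_upwards [ae_restrict_mem measurableSet_Ioc] with x hx
      exact Real.rpow_nonneg (le_of_lt hx.1) _

/-- distributional form of the Lorentz norm -/
noncomputable def distI {α : Type*} [MeasurableSpace α] (μ : Measure α)
    (f : α → ENNReal) (q s : ℝ) : ENNReal :=
  ∫⁻ l in Ioi (0 : ℝ), ENNReal.ofReal (l ^ (s - 1)) * μ {x | ENNReal.ofReal l < f x} ^ (s / q)

lemma meas_dist {α : Type*} [MeasurableSpace α] (μ : Measure α) (f : α → ENNReal) :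
    Measurable (fun l : ℝ => μ {x | ENNReal.ofReal l < f x}) := by
  apply Antitone.measurable
  intro a b hab
  exact measure_mono fun x hx => lt_of_le_of_lt (ENNReal.ofReal_le_ofReal hab) hx

lemma lorentz_eq {α : Type*} [MeasurableSpace α] (μ : Measure α)
    (f : α → ENNReal) (q : ℝ) (hq : 0 < q) (σ : ENNReal) (hσ : 1 ≤ σ) (ht : σ ≠ ∞) :
    lorentzNorm μ f q σ = (ENNReal.ofReal q * distI μ f q σ.toReal) ^ (1 / σ.toReal) := by
  have hs : 0 < σ.toReal := ENNReal.toReal_pos (by positivity) ht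
  rw [lorentzNorm, if_neg ht]
  congr 1
  set s := σ.toReal
  have hp : 0 < s / q := by positivity
  have mr : Measurable (fun t : ℝ => rearrangement μ f (ENNReal.ofReal t)) := by
    apply Antitone.measurable
    intro a b hab
    exact sInf_le_sInf fun l hl => le_trans hl (ENNReal.ofReal_le_ofReal hab)
  calc _ = ∫⁻ t in Ioi (0 : ℝ), ENNReal.ofReal s * ∫⁻ l in Ioi (0 : ℝ),
          (if ENNReal.ofReal l < rearrangement μ f (ENNReal.ofReal t) then
            ENNReal.ofReal (l ^ (s - 1)) * ENNReal.ofReal (t ^ (s / q - 1)) else 0) := by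
        refine setLIntegral_congr_fun measurableSet_Ioi fun t (ht : 0 < t) => ?_
        have e : ∀ l : ℝ, (if ENNReal.ofReal l < rearrangement μ f (ENNReal.ofReal t) then
            ENNReal.ofReal (l ^ (s - 1)) * ENNReal.ofReal (t ^ (s / q - 1)) else 0)
            = (if ENNReal.ofReal l < rearrangement μ f (ENNReal.ofReal t) then
            ENNReal.ofReal (l ^ (s - 1)) else 0) * ENNReal.ofReal (t ^ (s / q - 1)) := by
          intro l; split_ifs <;> simp
        simp only [e]
        rw [lintegral_mul_const' _ _ ENNReal.ofReal_ne_top, powint _ _ hs,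
          ENNReal.mul_rpow_of_nonneg _ _ hs.le, ← ENNReal.rpow_mul,
          ENNReal.ofReal_rpow_of_pos ht]
        have e1 : ENNReal.ofReal s * ENNReal.ofReal (1 / s) = 1 := by
          rw [← ENNReal.ofReal_mul hs.le]; simp [hs.ne']
        have e2 : ENNReal.ofReal (t ^ (s / q - 1))
            = ENNReal.ofReal (t ^ (1 / q * s)) * ENNReal.ofReal (1 / t) := by
          rw [← ENNReal.ofReal_mul (by positivity), Real.rpow_sub ht, Real.rpow_one,
            div_eq_mul_one_div]
          congr 4; ring
        rw [e2]
        calc _ = (ENNReal.ofReal s * ENNReal.ofReal (1 / s)) * (ENNReal.ofReal (t ^ (1 / q * s)) * rearrangement μ f (ENNReal.ofReal t) ^ s *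
              ENNReal.ofReal (1 / t)) := by rw [e1, one_mul]
          _ = _ := by ring
    _ = ENNReal.ofReal s * ∫⁻ t in Ioi (0 : ℝ), ∫⁻ l in Ioi (0 : ℝ),
          (if ENNReal.ofReal l < rearrangement μ f (ENNReal.ofReal t) then
            ENNReal.ofReal (l ^ (s - 1)) * ENNReal.ofReal (t ^ (s / q - 1)) else 0) := by
        rw [lintegral_const_mul' _ _ ENNReal.ofReal_ne_top]
    _ = ENNReal.ofReal s * ∫⁻ l in Ioi (0 : ℝ), ∫⁻ t in Ioi (0 : ℝ),
          (if ENNReal.ofReal l < rearrangement μ f (ENNReal.ofReal t) then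
            ENNReal.ofReal (l ^ (s - 1)) * ENNReal.ofReal (t ^ (s / q - 1)) else 0) := by
        rw [lintegral_lintegral_swap]
        refine Measurable.aemeasurable ?_
        refine Measurable.ite (measurableSet_lt (by fun_prop) (mr.comp measurable_fst))
          (by fun_prop) (by fun_prop)
    _ = ENNReal.ofReal s * ∫⁻ l in Ioi (0 : ℝ), ENNReal.ofReal (1 / (s / q)) *
          (ENNReal.ofReal (l ^ (s - 1)) * μ {x | ENNReal.ofReal l < f x} ^ (s / q)) := by
        congr 1
        refine lintegral_congr fun l => ?_
        have e : ∀ t : ℝ, (if ENNReal.ofReal l < rearrangement μ f (ENNReal.ofReal t) then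
            ENNReal.ofReal (l ^ (s - 1)) * ENNReal.ofReal (t ^ (s / q - 1)) else 0)
            = ENNReal.ofReal (l ^ (s - 1)) * (if ENNReal.ofReal t < μ {x | ENNReal.ofReal l < f x} then
              ENNReal.ofReal (t ^ (s / q - 1)) else 0) := by
          intro t
          simp only [lt_rearr_iff]
          split_ifs <;> simp
        simp only [e]
        rw [lintegral_const_mul' _ _ ENNReal.ofReal_ne_top, powint _ _ hp]
        ring
    _ = _ := by
        rw [lintegral_const_mul' _ _ ENNReal.ofReal_ne_top, ← mul_assoc,
          ← ENNReal.ofReal_mul hs.le, distI]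
        congr 2
        field_simp

lemma distI_scale {α : Type*} [MeasurableSpace α] (μ : Measure α)
    (f : α → ENNReal) (q s a : ℝ) (ha : 0 < a) :
    ∫⁻ l in Ioi (0 : ℝ), ENNReal.ofReal (l ^ (s - 1)) *
        μ {x | ENNReal.ofReal (a * l) < f x} ^ (s / q)
      = ENNReal.ofReal (a ^ (-s)) * distI μ f q s := by
  set G : ℝ → ENNReal := fun l => (Ioi (0:ℝ)).indicator (fun l => ENNReal.ofReal (l ^ (s - 1)) * μ {x | ENNReal.ofReal l < f x} ^ (s / q)) l with hG
  have hm : Measurable G := by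
    refine Measurable.indicator ?_ measurableSet_Ioi
    exact Measurable.mul (by fun_prop) ((meas_dist μ f).pow_const _)
  have h1 : distI μ f q s = ∫⁻ l, G l := by
    rw [distI, ← lintegral_indicator measurableSet_Ioi]
  have h2 : ∫⁻ l, G l = ENNReal.ofReal a * ∫⁻ l, G (a * l) := by
    conv_lhs => rw [← Real.smul_map_volume_mul_left ha.ne']
    rw [lintegral_smul_measure, lintegral_map hm (by fun_prop), abs_of_pos ha, smul_eq_mul]
  rw [h1, h2, ← mul_assoc, ← ENNReal.ofReal_mul (by positivity),
    ← lintegral_indicator measurableSet_Ioi, ← lintegral_const_mul' _ _ ENNReal.ofReal_ne_top]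
  refine lintegral_congr fun l => ?_
  by_cases hl : 0 < l
  · have : 0 < a * l := by positivity
    simp only [hG, indicator, mem_Ioi, hl, this, if_true]
    rw [← mul_assoc, ← ENNReal.ofReal_mul (by positivity), Real.mul_rpow ha.le hl.le,
      Real.rpow_sub ha, Real.rpow_neg ha.le, Real.rpow_one]
    congr 2
    have : a ^ s ≠ 0 := by positivity
    field_simp
  · have : ¬ 0 < a * l := by
      intro h; exact hl (pos_of_mul_pos_right h ha.le)
    simp [hG, indicator, hl, this]

lemma tsum_rpow_le {ι : Type*} (g : ι → ENNReal) {p : ℝ} (hp : 0 < p) (hp1 : p ≤ 1) :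
    (∑' i, g i) ^ p ≤ ∑' i, g i ^ p := by
  have : Filter.Tendsto (fun s : Finset ι => (∑ i ∈ s, g i) ^ p) Filter.atTop
      (nhds ((∑' i, g i) ^ p)) :=
    (ENNReal.continuous_rpow_const.tendsto _).comp ENNReal.summable.hasSum
  refine le_of_tendsto' this fun s => ?_
  refine le_trans ?_ (ENNReal.sum_le_tsum s)
  classical
  induction s using Finset.induction_on with
  | empty => simp [ENNReal.zero_rpow_of_pos hp]
  | insert a s ha ih =>
    rw [Finset.sum_insert ha, Finset.sum_insert ha]
    exact (ENNReal.rpow_add_le_add_rpow _ _ hp.le hp1).trans (by gcongr)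

lemma Lp_tsum_le {β ι : Type*} [Countable ι] [MeasurableSpace β] (ν : Measure β)
    (g : ι → β → ENNReal) (hg : ∀ i, Measurable (g i)) {p : ℝ} (hp : 1 ≤ p) :
    (∫⁻ x, (∑' i, g i x) ^ p ∂ν) ^ (1 / p) ≤ ∑' i, (∫⁻ x, g i x ^ p ∂ν) ^ (1 / p) := by
  have hp0 : 0 < p := by linarith
  have e : ∀ x, (∑' i, g i x) ^ p = ⨆ s : Finset ι, (∑ i ∈ s, g i x) ^ p := by
    intro x
    rw [ENNReal.tsum_eq_iSup_sum]
    exact (ENNReal.orderIsoRpow p hp0).map_iSup _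
  simp only [e]
  rw [lintegral_iSup_directed]
  · have := (ENNReal.orderIsoRpow (1 / p) (by positivity)).map_iSup
      (fun s : Finset ι => ∫⁻ x, (∑ i ∈ s, g i x) ^ p ∂ν)
    simp only [ENNReal.orderIsoRpow_apply] at this
    rw [this]
    refine iSup_le fun s => ?_
    refine le_trans ?_ (ENNReal.sum_le_tsum s)
    classical
    induction s using Finset.induction_on with
    | empty => simp [ENNReal.zero_rpow_of_pos hp0, ENNReal.zero_rpow_of_pos (inv_pos.2 hp0)]
    | insert a s ha ih =>
      simp only [Finset.sum_insert ha]
      refine le_trans (ENNReal.lintegral_Lp_add_le (hg a).aemeasurable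
        (g := fun x => ∑ i ∈ s, g i x) ?_ hp) (by gcongr)
      exact (Finset.measurable_sum s fun i _ => hg i).aemeasurable
  · intro s
    exact ((Finset.measurable_sum s fun i _ => hg i).pow_const p).aemeasurable
  · refine Monotone.directed_le ?_
    intro s t hst x
    exact ENNReal.rpow_le_rpow (Finset.sum_le_sum_of_subset hst) hp0.le

/-- dyadic scale -/
noncomputable def dyA (k : ℕ) : ℝ := (1 / 2) ^ (k + 1)

/-- dyadic weight -/
noncomputable def dyB (r : ℝ) (k : ℕ) : ℝ := ((1 / 2) ^ k) ^ r

lemma dyA_pos (k : ℕ) : 0 < dyA k := by unfold dyA; positivity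

lemma dyB_pos (r : ℝ) (k : ℕ) : 0 < dyB r k := by unfold dyB; positivity

/-- the constant -/
noncomputable def dyD (q r p : ℝ) : ENNReal :=
  ∑' k, ENNReal.ofReal ((dyB r k * dyA k ^ (-q)) ^ p)

lemma dyD_ne_top (q r p : ℝ) (hqr : q < r) (hp : 0 < p) : dyD q r p ≠ ∞ := by
  have e : ∀ k, (dyB r k * dyA k ^ (-q)) ^ p = 2 ^ (q * p) * (2 ^ ((q - r) * p)) ^ k := by
    intro k
    have h : (1 / 2 : ℝ) = 2 ^ (-1 : ℝ) := by rw [Real.rpow_neg_one]; norm_num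
    unfold dyA dyB
    simp only [h, ← Real.rpow_natCast, ← Real.rpow_mul (zero_le_two : (0:ℝ) ≤ 2),
      ← Real.rpow_add (zero_lt_two : (0:ℝ) < 2)]
    congr 1
    push_cast
    ring
  unfold dyD
  simp only [e]
  have hs : Summable fun k : ℕ => (2:ℝ) ^ (q * p) * (2 ^ ((q - r) * p)) ^ k := by
    refine (summable_geometric_of_lt_one (by positivity) ?_).mul_left _
    exact Real.rpow_lt_one_of_one_lt_of_neg one_lt_two (mul_neg_of_neg_of_pos (by linarith) hp)
  exact hs.tsum_ofReal_ne_top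

lemma key_term (r : ℝ) (hr : 0 < r) (l : ℝ) (hl : 0 < l) (y : ENNReal) (hy : y ≤ ENNReal.ofReal l) :
    y ^ r ≤ (∑' k : ℕ, ENNReal.ofReal (dyB r k) *
      (if ENNReal.ofReal (dyA k * l) < y then 1 else 0)) * ENNReal.ofReal l ^ r := by
  rcases eq_or_ne y 0 with rfl | h0
  · simp [ENNReal.zero_rpow_of_pos hr]
  lift y to NNReal using ne_top_of_le_ne_top ENNReal.ofReal_ne_top hy
  have hy' : (y : ℝ) ≤ l := by
    rwa [← ENNReal.ofReal_coe_nnreal, ENNReal.ofReal_le_ofReal_iff hl.le] at hy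
  have hpos : 0 < (y : ℝ) := by
    have : y ≠ 0 := by simpa using h0
    positivity
  have hlt : ∀ k, ENNReal.ofReal (dyA k * l) < (y : ENNReal) ↔ dyA k * l < y := by
    intro k
    rw [← ENNReal.ofReal_coe_nnreal, ENNReal.ofReal_lt_ofReal_iff hpos]
  have hex : ∃ k, dyA k * l < y := by
    obtain ⟨n, hn⟩ := exists_pow_lt_of_lt_one (div_pos hpos hl) (by norm_num : (1 / 2 : ℝ) < 1)
    refine ⟨n, ?_⟩
    rw [lt_div_iff₀ hl] at hn
    refine lt_of_le_of_lt ?_ hn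
    gcongr
    unfold dyA
    exact pow_le_pow_of_le_one (by norm_num) (by norm_num) (Nat.le_succ n)
  classical
  obtain ⟨k, hk, hmin⟩ : ∃ k, dyA k * l < y ∧ (y : ℝ) ≤ (1 / 2) ^ k * l := by
    refine ⟨Nat.find hex, Nat.find_spec hex, ?_⟩
    rcases h : Nat.find hex with _ | m
    · simpa using hy'
    · have := Nat.find_min hex (m := m) (by omega)
      exact not_lt.1 this
  calc (y : ENNReal) ^ r ≤ ENNReal.ofReal (dyB r k) * ENNReal.ofReal l ^ r := by
        rw [ENNReal.ofReal_rpow_of_pos hl, ← ENNReal.ofReal_mul (dyB_pos r k).le, dyB,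
          ← Real.mul_rpow (by positivity) hl.le, ← ENNReal.ofReal_rpow_of_pos (by positivity)]
        refine ENNReal.rpow_le_rpow ?_ hr.le
        rw [← ENNReal.ofReal_coe_nnreal]
        exact ENNReal.ofReal_le_ofReal hmin
    _ = (ENNReal.ofReal (dyB r k) * (if ENNReal.ofReal (dyA k * l) < (y : ENNReal) then 1 else 0))
          * ENNReal.ofReal l ^ r := by
        rw [if_pos ((hlt k).2 hk), mul_one]
    _ ≤ _ := by
        gcongr
        exact ENNReal.le_tsum (f := fun k : ℕ => ENNReal.ofReal (dyB r k) *
          (if ENNReal.ofReal (dyA k * l) < (y : ENNReal) then 1 else 0)) k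

lemma dist_bound {α : Type*} [MeasurableSpace α] (μ : Measure α) (G : ℤ → α → ENNReal)
    (hG : ∀ j, Measurable (G j)) (r : ℝ) (hr : 0 < r) (l : ℝ) (hl : 0 < l) :
    μ {x | ENNReal.ofReal l < (∑' j, G j x ^ r) ^ (1 / r)}
      ≤ ∑' i : ℤ × ℕ, ENNReal.ofReal (dyB r i.2) *
          μ {x | ENNReal.ofReal (dyA i.2 * l) < G i.1 x} := by
  have hms : ∀ (c : ENNReal) j, MeasurableSet {x | c < G j x} := fun c j =>
    measurableSet_lt measurable_const (hG j)
  have e : ∀ i : ℤ × ℕ, ENNReal.ofReal (dyB r i.2) *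
          μ {x | ENNReal.ofReal (dyA i.2 * l) < G i.1 x}
      = ∫⁻ x, ENNReal.ofReal (dyB r i.2) *
        (if ENNReal.ofReal (dyA i.2 * l) < G i.1 x then 1 else 0) ∂μ := by
    intro i
    rw [lintegral_const_mul' _ _ ENNReal.ofReal_ne_top, ← lintegral_indicator_one (hms _ _)]
    simp [indicator]
  simp only [e]
  rw [← lintegral_tsum]
  swap
  · intro i
    refine Measurable.aemeasurable (Measurable.const_mul ?_ _)
    exact Measurable.ite (hms _ _) measurable_const measurable_const
  have hmf : MeasurableSet {x | ENNReal.ofReal l < (∑' j, G j x ^ r) ^ (1 / r)} := by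
    refine measurableSet_lt measurable_const ?_
    exact (Measurable.tsum fun j => (hG j).pow_const r).pow_const _
  rw [← lintegral_indicator_one hmf]
  refine lintegral_mono fun x => ?_
  by_cases hx : ENNReal.ofReal l < (∑' j, G j x ^ r) ^ (1 / r)
  swap
  · rw [indicator_of_notMem (by exact hx)]; exact zero_le
  rw [indicator_of_mem (by exact hx), Pi.one_apply, ENNReal.tsum_prod (f := fun (j : ℤ) (k : ℕ) => ENNReal.ofReal (dyB r k) *
        (if ENNReal.ofReal (dyA k * l) < G j x then 1 else 0))]
  by_cases hc : ∃ j, ENNReal.ofReal l < G j x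
  · obtain ⟨j, hj⟩ := hc
    refine le_trans ?_ (ENNReal.le_tsum j)
    refine le_trans ?_ (ENNReal.le_tsum 0)
    rw [if_pos]
    · simp [dyB]
    · refine lt_of_le_of_lt (ENNReal.ofReal_le_ofReal ?_) hj
      unfold dyA; norm_num; linarith
  · push Not at hc
    have h1 : ENNReal.ofReal l ^ r < ∑' j, G j x ^ r := by
      have := ENNReal.rpow_lt_rpow hx hr
      rwa [← ENNReal.rpow_mul, one_div_mul_cancel hr.ne', ENNReal.rpow_one] at this
    have h2 := h1.le.trans (ENNReal.tsum_le_tsum fun j => key_term r hr l hl (G j x) (hc j))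
    rw [ENNReal.tsum_mul_right] at h2
    have hp0 : ENNReal.ofReal l ^ r ≠ 0 := by
      rw [ENNReal.ofReal_rpow_of_pos hl]; simp; positivity
    have hpt : ENNReal.ofReal l ^ r ≠ ∞ := by
      rw [ENNReal.ofReal_rpow_of_pos hl]; simp
    rw [← ENNReal.mul_le_mul_iff_left hp0 hpt, one_mul]
    exact h2

lemma finish (D : ENNReal) (hD : D ≠ ∞) (w : ℝ) (hw : 0 < w) :
    ∃ C : ℝ, 0 < C ∧ ∀ N S : ENNReal, N ≤ (D * S) ^ (1 / w) → N ≤ ENNReal.ofReal C * S ^ (1 / w) := by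
  refine ⟨(D.toReal + 1) ^ (1 / w), by positivity, fun N S h => h.trans ?_⟩
  rw [ENNReal.mul_rpow_of_nonneg _ _ (by positivity),
    ← ENNReal.ofReal_rpow_of_pos (by positivity)]
  gcongr
  rw [ENNReal.le_ofReal_iff_toReal_le hD (by positivity)]
  linarith

lemma sum_split (q r p : ℝ) (M : ℤ → ENNReal) :
    ∑' i : ℤ × ℕ, ENNReal.ofReal ((dyB r i.2 * dyA i.2 ^ (-q)) ^ p) * M i.1
      = dyD q r p * ∑' j, M j := by
  rw [ENNReal.tsum_prod (f := fun (j : ℤ) (k : ℕ) =>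
    ENNReal.ofReal ((dyB r k * dyA k ^ (-q)) ^ p) * M j)]
  simp only [ENNReal.tsum_mul_right, ENNReal.tsum_mul_left, dyD]

lemma case_top {α : Type*} [MeasurableSpace α] (μ : Measure α) (G : ℤ → α → ENNReal)
    (hG : ∀ j, Measurable (G j)) (q r : ℝ) (hq : 0 < q) (hqr : q < r) :
    lorentzNorm μ (fun x => (∑' j, G j x ^ r) ^ (1 / r)) q ∞
      ≤ (dyD q r 1 * ∑' j, lorentzNorm μ (G j) q ∞ ^ q) ^ (1 / q) := by
  have hlow : ∀ j (l : ℝ), 0 < l →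
      μ {x | ENNReal.ofReal l < G j x} ≤ ENNReal.ofReal (l ^ (-q)) * lorentzNorm μ (G j) q ∞ ^ q := by
    intro j l hl
    refine ENNReal.le_of_forall_nnreal_lt fun t ht => ?_
    rw [← lt_rearr_iff] at ht
    have h1 : (t : ENNReal) ^ (1 / q) * ENNReal.ofReal l ≤ lorentzNorm μ (G j) q ∞ := by
      rw [lorentzNorm, if_pos rfl]
      refine le_trans ?_ (le_iSup _ t)
      gcongr
    have h2 := ENNReal.rpow_le_rpow h1 hq.le
    rw [ENNReal.mul_rpow_of_nonneg _ _ hq.le, ← ENNReal.rpow_mul, one_div_mul_cancel hq.ne',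
      ENNReal.rpow_one, ENNReal.ofReal_rpow_of_pos hl] at h2
    calc (t : ENNReal) = ENNReal.ofReal (l ^ (-q)) * (t * ENNReal.ofReal (l ^ q)) := by
          rw [mul_left_comm, ← ENNReal.ofReal_mul (by positivity), ← Real.rpow_add hl]
          simp
      _ ≤ _ := by gcongr
  set K := dyD q r 1 * ∑' j, lorentzNorm μ (G j) q ∞ ^ q with hK
  have hup : ∀ l : ℝ, 0 < l → μ {x | ENNReal.ofReal l < (∑' j, G j x ^ r) ^ (1 / r)}
      ≤ ENNReal.ofReal (l ^ (-q)) * K := by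
    intro l hl
    refine (dist_bound μ G hG r (hq.trans hqr) l hl).trans ?_
    rw [hK, ← sum_split, ← ENNReal.tsum_mul_left]
    refine ENNReal.tsum_le_tsum fun i => ?_
    have ha := dyA_pos i.2
    have hb := dyB_pos r i.2
    refine (mul_le_mul_right (hlow i.1 (dyA i.2 * l) (by positivity)) _).trans (le_of_eq ?_)
    rw [Real.mul_rpow ha.le hl.le, Real.rpow_one, ← mul_assoc, ← mul_assoc,
      ← ENNReal.ofReal_mul (by positivity), ← ENNReal.ofReal_mul (by positivity)]
    congr 2
    ring
  rw [lorentzNorm, if_pos rfl]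
  refine iSup_le fun t => ?_
  rw [mul_comm]
  refine ENNReal.mul_le_of_forall_lt ?_
  intro l' hl' t' ht'
  rcases eq_or_ne l' 0 with rfl | h0
  · simp
  lift l' to NNReal using hl'.ne_top
  rw [lt_rearr_iff] at hl'
  have hl : 0 < (l' : ℝ) := by
    have : l' ≠ 0 := by simpa using h0
    positivity
  have h0 := hup _ hl
  rw [ENNReal.ofReal_coe_nnreal] at h0
  have h1 := hl'.le.trans h0
  calc (l' : ENNReal) * t' ≤ l' * (t : ENNReal) ^ (1 / q) := by gcongr
    _ ≤ l' * (ENNReal.ofReal ((l' : ℝ) ^ (-q)) * K) ^ (1 / q) := by gcongr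
    _ = ENNReal.ofReal l' * ENNReal.ofReal (((l' : ℝ) ^ (-q)) ^ (1 / q)) * K ^ (1 / q) := by
        rw [ENNReal.mul_rpow_of_nonneg _ _ (by positivity),
          ENNReal.ofReal_rpow_of_pos (by positivity), ENNReal.ofReal_coe_nnreal, mul_assoc]
    _ = K ^ (1 / q) := by
        rw [← ENNReal.ofReal_mul hl.le, ← Real.rpow_mul hl.le]
        have : -q * (1 / q) = -1 := by field_simp
        rw [this, Real.rpow_neg_one, mul_inv_cancel₀ hl.ne']
        simp

lemma coef_eq (q r s : ℝ) (hq : 0 < q) (k : ℕ) :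
    dyB r k ^ (s / q) * dyA k ^ (-s) = (dyB r k * dyA k ^ (-q)) ^ (s / q) := by
  have ha := dyA_pos k
  have hb := dyB_pos r k
  rw [Real.mul_rpow hb.le (by positivity), ← Real.rpow_mul ha.le]
  congr 2
  field_simp

lemma scale_term {α : Type*} [MeasurableSpace α] (μ : Measure α) (f : α → ENNReal)
    (q r s : ℝ) (hq : 0 < q) (hs : 0 < s) (k : ℕ) :
    ∫⁻ l in Ioi (0 : ℝ), ENNReal.ofReal (l ^ (s - 1)) * (ENNReal.ofReal (dyB r k) *
        μ {x | ENNReal.ofReal (dyA k * l) < f x}) ^ (s / q)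
      = ENNReal.ofReal ((dyB r k * dyA k ^ (-q)) ^ (s / q)) * distI μ f q s := by
  have hb := dyB_pos r k
  have ha := dyA_pos k
  rw [← coef_eq q r s hq k, ENNReal.ofReal_mul (by positivity), mul_assoc,
    ← distI_scale μ f q s _ ha, ← lintegral_const_mul' _ _ ENNReal.ofReal_ne_top]
  refine lintegral_congr fun l => ?_
  rw [ENNReal.mul_rpow_of_nonneg _ _ (by positivity), ENNReal.ofReal_rpow_of_pos hb]
  ring

lemma case_small {α : Type*} [MeasurableSpace α] (μ : Measure α) (G : ℤ → α → ENNReal)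
    (hG : ∀ j, Measurable (G j)) (q r s : ℝ) (hq : 0 < q) (hqr : q < r) (hs : 0 < s) (hsq : s ≤ q) :
    distI μ (fun x => (∑' j, G j x ^ r) ^ (1 / r)) q s
      ≤ dyD q r (s / q) * ∑' j, distI μ (G j) q s := by
  rw [← sum_split]
  simp only [← scale_term μ _ q r s hq hs]
  rw [← lintegral_tsum]
  swap
  · intro i
    refine Measurable.aemeasurable (Measurable.mul (by fun_prop) (Measurable.pow_const ?_ _))
    exact ((meas_dist μ (G i.1)).comp (measurable_const_mul (dyA i.2))).const_mul _
  refine setLIntegral_mono' measurableSet_Ioi fun l hl => ?_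
  rw [ENNReal.tsum_mul_left]
  gcongr
  refine (ENNReal.rpow_le_rpow (dist_bound μ G hG r (hq.trans hqr) l hl) (by positivity)).trans ?_
  exact tsum_rpow_le _ (by positivity) ((div_le_one hq).2 hsq)

lemma case_big {α : Type*} [MeasurableSpace α] (μ : Measure α) (G : ℤ → α → ENNReal)
    (hG : ∀ j, Measurable (G j)) (q r s : ℝ) (hq : 0 < q) (hqr : q < r) (hs : 0 < s) (hsq : q ≤ s) :
    distI μ (fun x => (∑' j, G j x ^ r) ^ (1 / r)) q s ^ (1 / (s / q))
      ≤ dyD q r 1 * ∑' j, distI μ (G j) q s ^ (1 / (s / q)) := by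
  have hp : 0 < s / q := by positivity
  rw [← sum_split]
  have e : ∀ i : ℤ × ℕ, ENNReal.ofReal ((dyB r i.2 * dyA i.2 ^ (-q)) ^ (1 : ℝ)) *
      distI μ (G i.1) q s ^ (1 / (s / q))
      = (∫⁻ l in Ioi (0 : ℝ), ENNReal.ofReal (l ^ (s - 1)) * (ENNReal.ofReal (dyB r i.2) *
        μ {x | ENNReal.ofReal (dyA i.2 * l) < G i.1 x}) ^ (s / q)) ^ (1 / (s / q)) := by
    intro i
    have hb := dyB_pos r i.2
    have ha := dyA_pos i.2
    rw [scale_term μ _ q r s hq hs, ENNReal.mul_rpow_of_nonneg _ _ (by positivity),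
      ENNReal.ofReal_rpow_of_pos (by positivity), ← Real.rpow_mul (by positivity),
      mul_one_div_cancel hp.ne']
  simp only [e]
  have hw : Measurable (fun l : ℝ => ENNReal.ofReal (l ^ (s - 1))) := by fun_prop
  have hm : ∀ i : ℤ × ℕ, Measurable (fun l : ℝ => ENNReal.ofReal (dyB r i.2) *
        μ {x | ENNReal.ofReal (dyA i.2 * l) < G i.1 x}) := fun i =>
    ((meas_dist μ (G i.1)).comp (measurable_const_mul (dyA i.2))).const_mul _
  have wd : ∀ g : ℝ → ENNReal, Measurable g →
      ∫⁻ l in Ioi (0 : ℝ), ENNReal.ofReal (l ^ (s - 1)) * g l ^ (s / q)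
      = ∫⁻ l, g l ^ (s / q) ∂((volume.restrict (Ioi (0:ℝ))).withDensity
          (fun l : ℝ => ENNReal.ofReal (l ^ (s - 1)))) := by
    intro g hg
    rw [lintegral_withDensity_eq_lintegral_mul _ hw (hg.pow_const _)]
    rfl
  simp only [fun i => wd _ (hm i)]
  refine le_trans ?_ (Lp_tsum_le _ _ hm ((one_le_div hq).2 hsq))
  rw [← wd _ (Measurable.tsum hm)]
  refine ENNReal.rpow_le_rpow ?_ (by positivity)
  refine setLIntegral_mono' measurableSet_Ioi fun l hl => ?_
  gcongr
  exact dist_bound μ G hG r (hq.trans hqr) l hl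

/-- Lorentz-space vector inequality: for `1 < q < r`, `1 ≤ σ ≤ ∞` and `ω = min{σ,q}`,
`‖(∑_j |F_j|^r)^{1/r}‖_{L^{q,σ}} ≤ C(q,σ,r) (∑_j ‖F_j‖_{L^{q,σ}}^ω)^{1/ω}`. -/
theorem stmt_5 (q r : ℝ) (σ : ENNReal) (hq : 1 < q) (hqr : q < r) (hσ : 1 ≤ σ) :
    ∃ C : ℝ, 0 < C ∧
      ∀ (α : Type) [MeasurableSpace α] (μ : Measure α) (F : ℤ → α → ℝ),
        (∀ j, Measurable (F j)) →
        lorentzNorm μ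
            (fun x => (∑' j : ℤ, ENNReal.ofReal |F j x| ^ r) ^ (1 / r)) q σ
          ≤ ENNReal.ofReal C *
            (∑' j : ℤ,
                (lorentzNorm μ (fun x => ENNReal.ofReal |F j x|) q σ)
                  ^ (min σ (ENNReal.ofReal q)).toReal)
              ^ (1 / (min σ (ENNReal.ofReal q)).toReal) := by
  have hq0 : 0 < q := by linarith
  have hGm : ∀ {α : Type} [MeasurableSpace α] (F : ℤ → α → ℝ), (∀ j, Measurable (F j)) →
      ∀ j, Measurable (fun x => ENNReal.ofReal |F j x|) := by
    intro α _ F hF j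
    exact ENNReal.measurable_ofReal.comp (measurable_norm.comp (hF j))
  rcases eq_or_ne σ ∞ with rfl | ht
  · have hmin : (min ∞ (ENNReal.ofReal q)).toReal = q := by
      rw [min_eq_right le_top, ENNReal.toReal_ofReal hq0.le]
    rw [hmin]
    obtain ⟨C, hC, h⟩ := finish (dyD q r 1) (dyD_ne_top q r 1 hqr one_pos) q hq0
    refine ⟨C, hC, fun α _ μ F hF => h _ _ ?_⟩
    exact case_top μ (fun j x => ENNReal.ofReal |F j x|) (hGm F hF) q r hq0 hqr
  have hs : 0 < σ.toReal := ENNReal.toReal_pos (by positivity) ht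
  simp only [fun (α : Type) [MeasurableSpace α] (μ : Measure α) (f : α → ENNReal) =>
    lorentz_eq μ f q hq0 σ hσ ht]
  rcases le_total σ (ENNReal.ofReal q) with hle | hle
  · have hsq : σ.toReal ≤ q := ENNReal.toReal_le_of_le_ofReal hq0.le hle
    rw [min_eq_left hle]
    obtain ⟨C, hC, h⟩ := finish (dyD q r (σ.toReal / q))
      (dyD_ne_top q r _ hqr (by positivity)) σ.toReal hs
    refine ⟨C, hC, fun α _ μ F hF => h _ _ ?_⟩
    refine ENNReal.rpow_le_rpow ?_ (by positivity)
    simp only [← ENNReal.rpow_mul, one_div_mul_cancel hs.ne', ENNReal.rpow_one]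
    rw [ENNReal.tsum_mul_left, mul_left_comm]
    gcongr
    exact case_small μ (fun j x => ENNReal.ofReal |F j x|) (hGm F hF) q r _ hq0 hqr hs hsq
  · have hsq : q ≤ σ.toReal := (ENNReal.ofReal_le_iff_le_toReal ht).1 hle
    rw [min_eq_right hle, ENNReal.toReal_ofReal hq0.le]
    obtain ⟨C, hC, h⟩ := finish (dyD q r 1) (dyD_ne_top q r 1 hqr one_pos) q hq0
    refine ⟨C, hC, fun α _ μ F hF => h _ _ ?_⟩
    have e1 : 1 / σ.toReal * q = 1 / (σ.toReal / q) := by field_simp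
    have e2 : 1 / σ.toReal = 1 / (σ.toReal / q) * (1 / q) := by field_simp
    simp only [← ENNReal.rpow_mul, e1]
    rw [e2, ENNReal.rpow_mul]
    refine ENNReal.rpow_le_rpow ?_ (by positivity)
    simp only [ENNReal.mul_rpow_of_nonneg _ _ (show 0 ≤ 1 / (σ.toReal / q) by positivity)]
    rw [ENNReal.tsum_mul_left, mul_left_comm]
    gcongr
    exact case_big μ (fun j x => ENNReal.ofReal |F j x|) (hGm F hF) q r _ hq0 hqr hs hsq
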